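/- Let φ be a C⁴ function on [-1,1] satisfying φ'(0) = φ''(0) = 0, φ'''(0) ≠ 0, and φ'(x) ≠ 0 for all x ∈ [-1,1] with x ≠ 0. Then there exist constants C > 0 and A ≥ 0, depending only on φ, such that for every integer N ≥ 2 and every sequence of complex numbers (a_n)_{n=1}^{N}, one has ‖∑_{n=1}^{N} a_n e(n x + n² φ(x))‖_{L²(-1,1)} ≤ C (log N)^A N^{1/12} (∑_{n=1}^{N} |a_n|²)^{1/2}. -/

import Mathlib

open MeasureTheory

/-- `e z = e^{2πiz}`. -/
noncomputable def e (t : ℝ) : ℂ := Complex.exp (2 * Real.pi * Complex.I * t)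

lemma norm_e (t : ℝ) : ‖e t‖ = 1 := by
  have h : e t = Complex.exp (((2 * Real.pi * t : ℝ) : ℂ) * Complex.I) := by
    unfold e; congr 1; push_cast; ring
  rw [h, Complex.norm_exp_ofReal_mul_I]

lemma continuous_e : Continuous e := by unfold e; fun_prop

lemma star_e (t : ℝ) : (starRingEnd ℂ) (e t) = e (-t) := by
  unfold e
  rw [← Complex.exp_conj]
  congr 1
  simp [Complex.conj_ofNat]

lemma e_add (s t : ℝ) : e (s + t) = e s * e t := by
  unfold e; rw [← Complex.exp_add]; congr 1; push_cast; ring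

/-- `p` and `q` are the first two derivatives of `φ` on `[α, β]`, and `q` is continuous there. -/
structure IsC2Phase (φ p q : ℝ → ℝ) (α β : ℝ) : Prop where
  cont : ContinuousOn φ (Set.Icc α β)
  cont_deriv : ContinuousOn p (Set.Icc α β)
  cont_deriv₂ : ContinuousOn q (Set.Icc α β)
  hasDerivAt : ∀ x ∈ Set.Ioo α β, HasDerivAt φ (p x) x
  hasDerivAt_deriv : ∀ x ∈ Set.Ioo α β, HasDerivAt p (q x) x

lemma IsC2Phase.mono {φ p q : ℝ → ℝ} {α β α' β' : ℝ} (H : IsC2Phase φ p q α β)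
    (hα : α ≤ α') (hβ : β' ≤ β) : IsC2Phase φ p q α' β' where
  cont := H.cont.mono (Set.Icc_subset_Icc hα hβ)
  cont_deriv := H.cont_deriv.mono (Set.Icc_subset_Icc hα hβ)
  cont_deriv₂ := H.cont_deriv₂.mono (Set.Icc_subset_Icc hα hβ)
  hasDerivAt x hx := H.hasDerivAt x (Set.Ioo_subset_Ioo hα hβ hx)
  hasDerivAt_deriv x hx := H.hasDerivAt_deriv x (Set.Ioo_subset_Ioo hα hβ hx)

/-- First derivative test for the phase `h (x + s φ(x))`. -/
lemma norm_integral_e_le {φ p q : ℝ → ℝ} {α β h s l V : ℝ} (H : IsC2Phase φ p q α β)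
    (hαβ : α ≤ β) (hh : h ≠ 0) (hl : 0 < l)
    (hg : ∀ x ∈ Set.Icc α β, l ≤ |1 + s * p x|)
    (hV : ∫ x in α..β, |s * q x| / (1 + s * p x) ^ 2 ≤ V) :
    ‖∫ x in α..β, e (h * (x + s * φ x))‖ ≤ (2 / l + V) / |h| := by
  have hg0 : ∀ x ∈ Set.Icc α β, 1 + s * p x ≠ 0 := fun x hx h0 => by
    have := hg x hx
    rw [h0, abs_zero] at this
    linarith
  have hgc : ContinuousOn (fun x => 1 + s * p x) (Set.Icc α β) :=
    continuousOn_const.add (continuousOn_const.mul H.cont_deriv)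
  have hec : ContinuousOn (fun x => e (h * (x + s * φ x))) (Set.Icc α β) :=
    continuous_e.comp_continuousOn
      (continuousOn_const.mul (continuousOn_id.add (continuousOn_const.mul H.cont)))
  set κ : ℂ := 2 * Real.pi * Complex.I * h with hκ
  have hκ0 : κ ≠ 0 := by
    simp [hκ, hh, Real.pi_ne_zero]
  have hκn : |h| ≤ ‖κ‖ := by
    have : ‖κ‖ = 2 * Real.pi * |h| := by
      simp [hκ, abs_of_pos Real.pi_pos]
    rw [this]
    nlinarith [Real.pi_gt_three, abs_nonneg h]
  have hh' : 0 < |h| := abs_pos.2 hh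
  set F : ℝ → ℂ := fun x => e (h * (x + s * φ x)) * (((1 + s * p x)⁻¹ : ℝ) : ℂ) / κ with hF
  set R : ℝ → ℂ := fun x => e (h * (x + s * φ x)) *
    (((s * q x) / (1 + s * p x) ^ 2 : ℝ) : ℂ) / κ with hR
  have hinvc : ContinuousOn (fun x => (1 + s * p x)⁻¹) (Set.Icc α β) := hgc.inv₀ hg0
  have hFc : ContinuousOn F (Set.Icc α β) :=
    (hec.mul (Complex.continuous_ofReal.comp_continuousOn hinvc)).div_const _
  have hquot : ContinuousOn (fun x => (s * q x) / (1 + s * p x) ^ 2) (Set.Icc α β) :=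
    (continuousOn_const.mul H.cont_deriv₂).div (hgc.pow 2) fun x hx => pow_ne_zero 2 (hg0 x hx)
  have hRc : ContinuousOn R (Set.Icc α β) :=
    (hec.mul (Complex.continuous_ofReal.comp_continuousOn hquot)).div_const _
  have hderiv : ∀ x ∈ Set.Ioo α β,
      HasDerivAt F (e (h * (x + s * φ x)) - R x) x := by
    intro x hx
    have hx' := Set.Ioo_subset_Icc_self hx
    have d1 : HasDerivAt (fun x => h * (x + s * φ x)) (h * (1 + s * p x)) x :=
      ((hasDerivAt_id x).add ((H.hasDerivAt x hx).const_mul s)).const_mul h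
    have d2 : HasDerivAt (fun x => e (h * (x + s * φ x)))
        (e (h * (x + s * φ x)) * (2 * Real.pi * Complex.I * ((h * (1 + s * p x) : ℝ) : ℂ))) x := by
      unfold e
      exact ((d1.ofReal_comp).const_mul _).cexp
    have d3 : HasDerivAt (fun x => (1 + s * p x)⁻¹) (-(s * q x) / (1 + s * p x) ^ 2) x :=
      (((H.hasDerivAt_deriv x hx).const_mul s).const_add 1).inv (hg0 x hx')
    have d4 := (d2.mul d3.ofReal_comp).div_const κ
    have hgx : (1 + (s : ℂ) * p x) ≠ 0 := by exact_mod_cast hg0 x hx'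
    refine HasDerivAt.congr_deriv (f := F) d4 ?_
    simp only [hR]
    rw [add_div, sub_eq_add_neg]
    congr 1
    · push_cast
      rw [div_eq_iff hκ0, hκ]
      field_simp
    · push_cast
      ring
  have iE : IntervalIntegrable (fun x => e (h * (x + s * φ x))) volume α β :=
    hec.intervalIntegrable_of_Icc hαβ
  have iR : IntervalIntegrable R volume α β := hRc.intervalIntegrable_of_Icc hαβ
  have ftc := intervalIntegral.integral_eq_sub_of_hasDerivAt_of_le hαβ hFc hderiv (iE.sub iR)
  rw [intervalIntegral.integral_sub iE iR] at ftc
  have hFn : ∀ x ∈ Set.Icc α β, ‖F x‖ ≤ (1 / l) / |h| := by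
    intro x hx
    simp only [hF]
    rw [norm_div, norm_mul, norm_e, one_mul, Complex.norm_real, Real.norm_eq_abs, abs_inv,
      ← one_div]
    have := hg x hx
    gcongr
  have hRn : ‖∫ x in α..β, R x‖ ≤ V / |h| := by
    calc ‖∫ x in α..β, R x‖ ≤ ∫ x in α..β, (|s * q x| / (1 + s * p x) ^ 2) / ‖κ‖ := by
          refine intervalIntegral.norm_integral_le_of_norm_le hαβ ?_ ?_
          · refine Filter.Eventually.of_forall fun x _ => le_of_eq ?_
            simp only [hR]
            rw [norm_div, norm_mul, norm_e, one_mul, Complex.norm_real, Real.norm_eq_abs, abs_div,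
              abs_of_nonneg (sq_nonneg (1 + s * p x))]
          · apply ContinuousOn.intervalIntegrable_of_Icc hαβ
            refine ContinuousOn.div_const ?_ _
            exact ((continuousOn_const.mul H.cont_deriv₂).abs).div (hgc.pow 2)
              fun x hx => pow_ne_zero 2 (hg0 x hx)
      _ = (∫ x in α..β, |s * q x| / (1 + s * p x) ^ 2) / ‖κ‖ :=
          intervalIntegral.integral_div _ _
      _ ≤ (∫ x in α..β, |s * q x| / (1 + s * p x) ^ 2) / |h| := by
          have : 0 ≤ ∫ x in α..β, |s * q x| / (1 + s * p x) ^ 2 :=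
            intervalIntegral.integral_nonneg hαβ fun x _ => by positivity
          gcongr
      _ ≤ V / |h| := by gcongr
  have : ∫ x in α..β, e (h * (x + s * φ x)) = F β - F α + ∫ x in α..β, R x := by
    rw [← ftc]; ring
  rw [this]
  calc ‖F β - F α + ∫ x in α..β, R x‖ ≤ ‖F β‖ + ‖F α‖ + ‖∫ x in α..β, R x‖ :=
        (norm_add_le _ _).trans (add_le_add_left (norm_sub_le _ _) _)
    _ ≤ (1 / l) / |h| + (1 / l) / |h| + V / |h| := by
        gcongr
        · exact hFn _ (Set.right_mem_Icc.2 hαβ)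
        · exact hFn _ (Set.left_mem_Icc.2 hαβ)
    _ = (2 / l + V) / |h| := by ring

/-- First derivative test for the phase `h (x + s φ(x))` with `φ'` monotone. -/
lemma norm_integral_e_le_of_monotone {φ p q : ℝ → ℝ} {α β h s l ε : ℝ}
    (H : IsC2Phase φ p q α β) (hαβ : α ≤ β) (hh : h ≠ 0) (hs : 0 ≤ s) (hl : 0 < l)
    (hε : |ε| = 1) (hq : ∀ x ∈ Set.Icc α β, 0 ≤ ε * q x)
    (hg : ∀ x ∈ Set.Icc α β, l ≤ |1 + s * p x|) :
    ‖∫ x in α..β, e (h * (x + s * φ x))‖ ≤ 4 / l / |h| := by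
  have hg0 : ∀ x ∈ Set.Icc α β, 1 + s * p x ≠ 0 := fun x hx h0 => by
    have := hg x hx
    rw [h0, abs_zero] at this
    linarith
  have hgc : ContinuousOn (fun x => 1 + s * p x) (Set.Icc α β) :=
    continuousOn_const.add (continuousOn_const.mul H.cont_deriv)
  have hV : ∫ x in α..β, |s * q x| / (1 + s * p x) ^ 2 ≤ 2 / l := by
    have h1 : ∫ x in α..β, |s * q x| / (1 + s * p x) ^ 2
        = ∫ x in α..β, (-ε) * (-(s * q x) / (1 + s * p x) ^ 2) := by
      refine intervalIntegral.integral_congr fun x hx => ?_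
      rw [Set.uIcc_of_le hαβ] at hx
      have h2 := hq x hx
      have : |s * q x| = ε * (s * q x) := by
        rw [← abs_of_nonneg (show 0 ≤ ε * (s * q x) by nlinarith), abs_mul ε, hε, one_mul]
      simp only [this]
      ring
    rw [h1, intervalIntegral.integral_const_mul,
      intervalIntegral.integral_eq_sub_of_hasDerivAt_of_le hαβ (hgc.inv₀ hg0)
        (fun x hx => (((H.hasDerivAt_deriv x hx).const_mul s).const_add 1).inv
          (hg0 x (Set.Ioo_subset_Icc_self hx)))]
    · have hb : ∀ x ∈ Set.Icc α β, |(1 + s * p x)⁻¹| ≤ 1 / l := fun x hx => by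
        rw [abs_inv, ← one_div]
        exact one_div_le_one_div_of_le hl (hg x hx)
      refine (le_abs_self _).trans ?_
      rw [abs_mul, abs_neg, hε, one_mul]
      refine (abs_sub _ _).trans ?_
      have h3 := hb β (Set.right_mem_Icc.2 hαβ)
      have h4 := hb α (Set.left_mem_Icc.2 hαβ)
      have : 2 / l = 1 / l + 1 / l := by ring
      simp only [Pi.inv_apply]
      linarith
    · apply ContinuousOn.intervalIntegrable_of_Icc hαβ
      exact (continuousOn_const.mul H.cont_deriv₂).neg.div (hgc.pow 2)
        fun x hx => pow_ne_zero 2 (hg0 x hx)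
  refine (norm_integral_e_le H hαβ hh hl hg hV).trans (le_of_eq ?_)
  ring

lemma sum_inv_natCast_le (N : ℕ) :
    ∑ d ∈ Finset.Icc 1 N, (1 : ℝ) / d ≤ 1 + Real.log N := by
  have h := harmonic_le_one_add_log N
  rw [harmonic_eq_sum_Icc] at h
  push_cast at h
  simpa [one_div] using h

lemma sum_inv_abs_sub_le {S : Finset ℕ} {N n : ℕ} (hS : S ⊆ Finset.range (N + 1)) (hn : n ≤ N) :
    ∑ m ∈ S.erase n, (1 : ℝ) / |(n : ℝ) - m| ≤ 2 * (1 + Real.log N) := by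
  have key : ∀ (T : Finset ℕ) (g : ℕ → ℕ), Set.InjOn g T → (∀ m ∈ T, g m ∈ Finset.Icc 1 N) →
      (∀ m ∈ T, |(n : ℝ) - m| = g m) →
      ∑ m ∈ T, (1 : ℝ) / |(n : ℝ) - m| ≤ 1 + Real.log N := by
    intro T g hg hT habs
    calc ∑ m ∈ T, (1 : ℝ) / |(n : ℝ) - m| = ∑ m ∈ T, (1 : ℝ) / (g m : ℝ) :=
          Finset.sum_congr rfl fun m hm => by rw [habs m hm]
      _ = ∑ d ∈ T.image g, (1 : ℝ) / d := (Finset.sum_image (f := fun d : ℕ => (1 : ℝ) / d) hg).symm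
      _ ≤ ∑ d ∈ Finset.Icc 1 N, (1 : ℝ) / d := by
          refine Finset.sum_le_sum_of_subset_of_nonneg ?_ fun _ _ _ => by positivity
          exact Finset.image_subset_iff.2 hT
      _ ≤ _ := sum_inv_natCast_le N
  rw [← Finset.sum_filter_add_sum_filter_not (S.erase n) (fun m => m < n)]
  have hmem : ∀ m ∈ S, m ≤ N := fun m hm => by
    have := Finset.mem_range.1 (hS hm); omega
  have h1 := key ((S.erase n).filter (fun m => m < n)) (fun m => n - m)
    (fun a ha b hb hab => by
      simp only [Finset.coe_filter, Set.mem_ofPred_eq] at ha hb hab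
      omega)
    (fun m hm => by
      simp only [Finset.mem_filter] at hm
      simp only [Finset.mem_Icc]
      omega)
    (fun m hm => by
      simp only [Finset.mem_filter] at hm
      have : (m : ℝ) ≤ n := by exact_mod_cast hm.2.le
      rw [Nat.cast_sub hm.2.le, abs_of_nonneg (by linarith)])
  have h2 := key ((S.erase n).filter (fun m => ¬ m < n)) (fun m => m - n)
    (fun a ha b hb hab => by
      simp only [Finset.coe_filter, Set.mem_ofPred_eq] at ha hb hab
      omega)
    (fun m hm => by
      simp only [Finset.mem_filter, Finset.mem_erase] at hm
      have := hmem m hm.1.2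
      simp only [Finset.mem_Icc]
      omega)
    (fun m hm => by
      simp only [Finset.mem_filter] at hm
      have h' : n ≤ m := by omega
      have : (n : ℝ) ≤ m := by exact_mod_cast h'
      rw [Nat.cast_sub h', abs_of_nonpos (by linarith), neg_sub])
  linarith

lemma sum_inv_one_add_abs_sub_le {S : Finset ℕ} {N n : ℕ} (hS : S ⊆ Finset.range (N + 1))
    (hn : n ≤ N) :
    ∑ m ∈ S, (1 : ℝ) / (1 + |(n : ℝ) - m|) ≤ 3 * (1 + Real.log N) := by
  have hlog : 0 ≤ Real.log N := Real.log_natCast_nonneg N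
  have h1 : ∑ m ∈ S.erase n, (1 : ℝ) / (1 + |(n : ℝ) - m|) ≤ 2 * (1 + Real.log N) := by
    refine le_trans (Finset.sum_le_sum fun m hm => ?_) (sum_inv_abs_sub_le hS hn)
    have hne : (n : ℝ) - m ≠ 0 :=
      sub_ne_zero.2 (by exact_mod_cast (Finset.mem_erase.1 hm).1.symm)
    have := abs_pos.2 hne
    apply one_div_le_one_div_of_le this
    linarith
  by_cases h : n ∈ S
  · rw [← Finset.sum_erase_add S _ h]
    simp only [sub_self, abs_zero, add_zero, div_one]
    linarith
  · rw [Finset.erase_eq_of_notMem h] at h1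
    linarith

/-- Schur's test for the matrix `1 / |n - m|`. -/
lemma sum_sum_div_abs_sub_le {S : Finset ℕ} {N : ℕ} (hS : S ⊆ Finset.range (N + 1)) (b : ℕ → ℝ) :
    ∑ n ∈ S, ∑ m ∈ S.erase n, b n * b m / |(n : ℝ) - m|
      ≤ 2 * (1 + Real.log N) * ∑ n ∈ S, b n ^ 2 := by
  have hle : ∀ n ∈ S, n ≤ N := fun n hn => by
    have := Finset.mem_range.1 (hS hn); omega
  have h1 : ∑ n ∈ S, ∑ m ∈ S.erase n, b n ^ 2 / |(n : ℝ) - m|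
      ≤ 2 * (1 + Real.log N) * ∑ n ∈ S, b n ^ 2 := by
    rw [Finset.mul_sum]
    refine Finset.sum_le_sum fun n hn => ?_
    calc ∑ m ∈ S.erase n, b n ^ 2 / |(n : ℝ) - m|
        = b n ^ 2 * ∑ m ∈ S.erase n, 1 / |(n : ℝ) - m| := by
          rw [Finset.mul_sum]
          exact Finset.sum_congr rfl fun m _ => by ring
      _ ≤ b n ^ 2 * (2 * (1 + Real.log N)) :=
          mul_le_mul_of_nonneg_left (sum_inv_abs_sub_le hS (hle n hn)) (sq_nonneg _)
      _ = _ := by ring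
  have h2 : ∑ n ∈ S, ∑ m ∈ S.erase n, b m ^ 2 / |(n : ℝ) - m|
      = ∑ n ∈ S, ∑ m ∈ S.erase n, b n ^ 2 / |(n : ℝ) - m| := by
    rw [Finset.sum_comm' (t' := S) (s' := fun m => S.erase m)]
    · exact Finset.sum_congr rfl fun n _ => Finset.sum_congr rfl fun m _ => by
        rw [abs_sub_comm]
    · intro x y
      simp only [Finset.mem_erase, ne_eq]
      tauto
  have h3 : ∑ n ∈ S, ∑ m ∈ S.erase n, b n * b m / |(n : ℝ) - m|
      ≤ ∑ n ∈ S, ∑ m ∈ S.erase n,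
        ((b n ^ 2 / |(n : ℝ) - m|) / 2 + (b m ^ 2 / |(n : ℝ) - m|) / 2) := by
    refine Finset.sum_le_sum fun n _ => Finset.sum_le_sum fun m _ => ?_
    have : b n * b m ≤ (b n ^ 2 + b m ^ 2) / 2 := by nlinarith [sq_nonneg (b n - b m)]
    calc b n * b m / |(n : ℝ) - m| ≤ ((b n ^ 2 + b m ^ 2) / 2) / |(n : ℝ) - m| := by gcongr
      _ = _ := by ring
  simp only [Finset.sum_add_distrib, ← Finset.sum_div] at h3
  rw [h2] at h3
  linarith

/-- The summand `a_n e(n x + n² φ(x))`. -/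
noncomputable def wave (φ : ℝ → ℝ) (a : ℕ → ℂ) (n : ℕ) (x : ℝ) : ℂ :=
  a n * e ((n : ℝ) * x + (n : ℝ) ^ 2 * φ x)

/-- The energy `∫_α^β |∑_{n ∈ S} a_n e(n x + n² φ(x))|² dx`. -/
noncomputable def energy (φ : ℝ → ℝ) (a : ℕ → ℂ) (S : Finset ℕ) (α β : ℝ) : ℝ :=
  ∫ x in α..β, ‖∑ n ∈ S, wave φ a n x‖ ^ 2

lemma norm_wave (φ : ℝ → ℝ) (a : ℕ → ℂ) (n : ℕ) (x : ℝ) : ‖wave φ a n x‖ = ‖a n‖ := by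
  rw [wave, norm_mul, norm_e, mul_one]

lemma continuousOn_wave {φ : ℝ → ℝ} {s : Set ℝ} (hφ : ContinuousOn φ s) (a : ℕ → ℂ) (n : ℕ) :
    ContinuousOn (wave φ a n) s :=
  continuousOn_const.mul (continuous_e.comp_continuousOn
    ((continuousOn_const.mul continuousOn_id).add (continuousOn_const.mul hφ)))

lemma continuousOn_sum_wave {φ : ℝ → ℝ} {s : Set ℝ} (hφ : ContinuousOn φ s) (a : ℕ → ℂ)
    (S : Finset ℕ) : ContinuousOn (fun x => ∑ n ∈ S, wave φ a n x) s :=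
  continuousOn_finsetSum _ fun n _ => continuousOn_wave hφ a n

lemma intervalIntegrable_normSq_sum_wave {φ : ℝ → ℝ} {α β : ℝ} (hαβ : α ≤ β)
    (hφ : ContinuousOn φ (Set.Icc α β)) (a : ℕ → ℂ) (S : Finset ℕ) :
    IntervalIntegrable (fun x => ‖∑ n ∈ S, wave φ a n x‖ ^ 2) volume α β :=
  ((continuousOn_sum_wave hφ a S).norm.pow 2).intervalIntegrable_of_Icc hαβ

lemma wave_mul_conj (φ : ℝ → ℝ) (a : ℕ → ℂ) (n m : ℕ) (x : ℝ) :
    wave φ a n x * (starRingEnd ℂ) (wave φ a m x) = (a n * (starRingEnd ℂ) (a m)) *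
      e (((n : ℝ) - m) * (x + ((n : ℝ) + m) * φ x)) := by
  have : ((n : ℝ) - m) * (x + ((n : ℝ) + m) * φ x)
      = ((n : ℝ) * x + (n : ℝ) ^ 2 * φ x) + -((m : ℝ) * x + (m : ℝ) ^ 2 * φ x) := by ring
  rw [this, e_add, wave, wave, map_mul, star_e]
  ring

/-- `T T*` and Schur's test, given first-derivative bounds on the kernel. -/
lemma energy_le_of_kernel {φ : ℝ → ℝ} {α β : ℝ} (hαβ : α ≤ β)
    (hφ : ContinuousOn φ (Set.Icc α β)) {S : Finset ℕ} {N : ℕ}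
    (hS : S ⊆ Finset.range (N + 1)) (w : ℕ → ℝ)
    (hK : ∀ n ∈ S, ∀ m ∈ S, n ≠ m →
      ‖∫ x in α..β, e (((n : ℝ) - m) * (x + ((n : ℝ) + m) * φ x))‖ ≤ w n * w m / |(n : ℝ) - m|)
    (a : ℕ → ℂ) :
    energy φ a S α β
      ≤ ∑ n ∈ S, ((β - α) + 2 * (1 + Real.log N) * w n ^ 2) * ‖a n‖ ^ 2 := by
  have hcont : ∀ n m, ContinuousOn
      (fun x => wave φ a n x * (starRingEnd ℂ) (wave φ a m x)) (Set.Icc α β) := fun n m =>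
    (continuousOn_wave hφ a n).mul
      (Complex.continuous_conj.comp_continuousOn (continuousOn_wave hφ a m))
  have hint : ∀ n m, IntervalIntegrable
      (fun x => wave φ a n x * (starRingEnd ℂ) (wave φ a m x)) volume α β := fun n m =>
    (hcont n m).intervalIntegrable_of_Icc hαβ
  have hint' : ∀ n, IntervalIntegrable
      (fun x => ∑ m ∈ S, wave φ a n x * (starRingEnd ℂ) (wave φ a m x)) volume α β := fun n =>
    (continuousOn_finsetSum S fun m _ => hcont n m).intervalIntegrable_of_Icc hαβ
  have h1 : ((energy φ a S α β : ℝ) : ℂ) =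
      ∑ n ∈ S, ∑ m ∈ S, ∫ x in α..β, wave φ a n x * (starRingEnd ℂ) (wave φ a m x) := by
    rw [energy, ← intervalIntegral.integral_ofReal]
    calc ∫ x in α..β, ((‖∑ n ∈ S, wave φ a n x‖ ^ 2 : ℝ) : ℂ)
        = ∫ x in α..β, ∑ n ∈ S, ∑ m ∈ S, wave φ a n x * (starRingEnd ℂ) (wave φ a m x) := by
          refine intervalIntegral.integral_congr fun x _ => ?_
          rw [Complex.ofReal_pow, ← Complex.mul_conj', map_sum, Finset.sum_mul_sum]
      _ = _ := by
          rw [intervalIntegral.integral_finsetSum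
            fun n _ => hint' n]
          exact Finset.sum_congr rfl fun n _ =>
            intervalIntegral.integral_finsetSum fun m _ => hint n m
  have hnn : 0 ≤ energy φ a S α β :=
    intervalIntegral.integral_nonneg hαβ fun x _ => by positivity
  have hdiag : ∀ n, ‖∫ x in α..β, wave φ a n x * (starRingEnd ℂ) (wave φ a n x)‖
      ≤ (β - α) * ‖a n‖ ^ 2 := fun n => by
    refine (intervalIntegral.norm_integral_le_of_norm_le_const (C := ‖a n‖ ^ 2)
      fun x _ => ?_).trans (le_of_eq ?_)
    · rw [norm_mul, RCLike.norm_conj, norm_wave, sq]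
    · rw [abs_of_nonneg (by linarith), mul_comm]
  have hoff : ∀ n ∈ S, ∀ m ∈ S.erase n,
      ‖∫ x in α..β, wave φ a n x * (starRingEnd ℂ) (wave φ a m x)‖
        ≤ (w n * ‖a n‖) * (w m * ‖a m‖) / |(n : ℝ) - m| := by
    intro n hn m hm
    simp only [wave_mul_conj]
    rw [intervalIntegral.integral_const_mul, norm_mul, norm_mul, RCLike.norm_conj]
    have := hK n hn m (Finset.mem_of_mem_erase hm) (Finset.ne_of_mem_erase hm).symm
    calc _ ≤ ‖a n‖ * ‖a m‖ * (w n * w m / |(n : ℝ) - m|) := by gcongr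
      _ = _ := by ring
  calc energy φ a S α β = ‖((energy φ a S α β : ℝ) : ℂ)‖ := by
        rw [Complex.norm_real, Real.norm_of_nonneg hnn]
    _ ≤ ∑ n ∈ S, ∑ m ∈ S, ‖∫ x in α..β, wave φ a n x * (starRingEnd ℂ) (wave φ a m x)‖ := by
        rw [h1]
        exact (norm_sum_le _ _).trans (Finset.sum_le_sum fun n _ => norm_sum_le _ _)
    _ ≤ ∑ n ∈ S, ((∑ m ∈ S.erase n, (w n * ‖a n‖) * (w m * ‖a m‖) / |(n : ℝ) - m|)
          + (β - α) * ‖a n‖ ^ 2) := by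
        refine Finset.sum_le_sum fun n hn => ?_
        rw [← Finset.sum_erase_add S _ hn]
        exact add_le_add (Finset.sum_le_sum (hoff n hn)) (hdiag n)
    _ ≤ 2 * (1 + Real.log N) * ∑ n ∈ S, (w n * ‖a n‖) ^ 2
          + ∑ n ∈ S, (β - α) * ‖a n‖ ^ 2 := by
        rw [Finset.sum_add_distrib]
        exact add_le_add_left (sum_sum_div_abs_sub_le hS fun n => w n * ‖a n‖) _
    _ = _ := by
        rw [Finset.mul_sum, ← Finset.sum_add_distrib]
        exact Finset.sum_congr rfl fun n _ => by ring

/-- The trivial bound by Cauchy–Schwarz. -/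
lemma energy_le_card {φ : ℝ → ℝ} {α β : ℝ} (hαβ : α ≤ β) (a : ℕ → ℂ) (S : Finset ℕ) :
    energy φ a S α β ≤ (β - α) * S.card * ∑ n ∈ S, ‖a n‖ ^ 2 := by
  have h : ∀ x, ‖∑ n ∈ S, wave φ a n x‖ ^ 2 ≤ S.card * ∑ n ∈ S, ‖a n‖ ^ 2 := fun x => by
    calc ‖∑ n ∈ S, wave φ a n x‖ ^ 2 ≤ (∑ n ∈ S, ‖a n‖) ^ 2 := by
          gcongr
          refine (norm_sum_le _ _).trans (le_of_eq ?_)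
          exact Finset.sum_congr rfl fun n _ => norm_wave φ a n x
      _ ≤ _ := sq_sum_le_card_mul_sum_sq
  refine (le_abs_self _).trans ?_
  have := intervalIntegral.norm_integral_le_of_norm_le_const (a := α) (b := β)
    (f := fun x => ‖∑ n ∈ S, wave φ a n x‖ ^ 2) (C := S.card * ∑ n ∈ S, ‖a n‖ ^ 2)
    fun x _ => by rw [Real.norm_of_nonneg (by positivity)]; exact h x
  rw [abs_of_nonneg (show 0 ≤ β - α by linarith)] at this
  calc _ ≤ _ := this
    _ = _ := by ring

lemma energy_union_le {φ : ℝ → ℝ} {α β : ℝ} (hαβ : α ≤ β)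
    (hφ : ContinuousOn φ (Set.Icc α β)) (a : ℕ → ℂ) {S T : Finset ℕ} (hST : Disjoint S T) :
    energy φ a (S ∪ T) α β ≤ 2 * energy φ a S α β + 2 * energy φ a T α β := by
  have hi := intervalIntegrable_normSq_sum_wave hαβ hφ a
  unfold energy
  rw [← intervalIntegral.integral_const_mul, ← intervalIntegral.integral_const_mul,
    ← intervalIntegral.integral_add ((hi S).const_mul 2) ((hi T).const_mul 2)]
  refine intervalIntegral.integral_mono_on hαβ (hi _)
    (((hi S).const_mul 2).add ((hi T).const_mul 2)) fun x _ => ?_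
  rw [Finset.sum_union hST]
  have h1 := norm_add_le (∑ n ∈ S, wave φ a n x) (∑ n ∈ T, wave φ a n x)
  have h2 : ‖∑ n ∈ S, wave φ a n x + ∑ n ∈ T, wave φ a n x‖ ^ 2
      ≤ (‖∑ n ∈ S, wave φ a n x‖ + ‖∑ n ∈ T, wave φ a n x‖) ^ 2 := by gcongr
  nlinarith [sq_nonneg (‖∑ n ∈ S, wave φ a n x‖ - ‖∑ n ∈ T, wave φ a n x‖)]

lemma energy_add_adjacent {φ : ℝ → ℝ} {α β γ : ℝ} (hαβ : α ≤ β) (hβγ : β ≤ γ)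
    (hφ : ContinuousOn φ (Set.Icc α γ)) (a : ℕ → ℂ) (S : Finset ℕ) :
    energy φ a S α γ = energy φ a S α β + energy φ a S β γ :=
  (intervalIntegral.integral_add_adjacent_intervals
    (intervalIntegrable_normSq_sum_wave hαβ (hφ.mono (Set.Icc_subset_Icc_right hβγ)) a S)
    (intervalIntegrable_normSq_sum_wave hβγ (hφ.mono (Set.Icc_subset_Icc_left hαβ)) a S)).symm

lemma energy_le_of_le_abs_deriv {φ p q : ℝ → ℝ} {α β ε t : ℝ} (H : IsC2Phase φ p q α β)
    (hαβ : α ≤ β) (hε : |ε| = 1) (hq : ∀ x ∈ Set.Icc α β, 0 ≤ ε * q x)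
    {S : Finset ℕ} {N : ℕ} (hS : S ⊆ Finset.range (N + 1)) (ht : 0 < t) (d : ℕ → ℝ)
    (hd : ∀ n ∈ S, 0 < d n)
    (hg : ∀ n ∈ S, ∀ m ∈ S, ∀ x ∈ Set.Icc α β,
      (d n + d m) / (2 * t) ≤ |1 + ((n : ℝ) + m) * p x|) (a : ℕ → ℂ) :
    energy φ a S α β
      ≤ ∑ n ∈ S, ((β - α) + 8 * (1 + Real.log N) * (t / d n)) * ‖a n‖ ^ 2 := by
  refine (energy_le_of_kernel hαβ H.cont hS (fun n => √(4 * t / d n)) ?_ a).trans (le_of_eq ?_)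
  · intro n hn m hm hnm
    have hdn := hd n hn
    have hdm := hd m hm
    have hl : 0 < √(d n) * √(d m) / t := by positivity
    have hh : (n : ℝ) - m ≠ 0 := sub_ne_zero.2 (by exact_mod_cast hnm)
    refine (norm_integral_e_le_of_monotone H hαβ hh (by positivity) hl hε hq
      fun x hx => ?_).trans (le_of_eq ?_)
    · refine le_trans ?_ (hg n hn m hm x hx)
      rw [div_le_div_iff₀ ht (by positivity)]
      have h1 := Real.sq_sqrt hdn.le
      have h2 := Real.sq_sqrt hdm.le
      nlinarith [sq_nonneg (√(d n) - √(d m))]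
    · congr 1
      rw [Real.sqrt_div (by positivity), Real.sqrt_div (by positivity), div_mul_div_comm,
        Real.mul_self_sqrt (by positivity)]
      field_simp
  · refine Finset.sum_congr rfl fun n hn => ?_
    have hdn := hd n hn
    rw [Real.sq_sqrt (by positivity)]
    ring

lemma exists_pow_six_le (n : ℕ) : ∃ j : ℕ, j ^ 6 ≤ n ∧ n < (j + 1) ^ 6 := by
  induction n with
  | zero => exact ⟨0, by norm_num⟩
  | succ n ih =>
    obtain ⟨j, h1, h2⟩ := ih
    by_cases h : n + 1 < (j + 1) ^ 6
    · exact ⟨j, by omega, h⟩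
    · refine ⟨j + 1, by omega, ?_⟩
      have : (j + 1) ^ 6 < (j + 1 + 1) ^ 6 := Nat.pow_lt_pow_left (by omega) (by norm_num)
      omega

lemma pow_six_div_sub_le {i j : ℝ} (hi : 0 ≤ i) (hij : i < j) :
    i ^ 6 / (j ^ 6 - i ^ 6) ≤ j / (j - i) ∧ j ^ 6 / (j ^ 6 - i ^ 6) ≤ j / (j - i) := by
  have hj : 0 < j := hi.trans_lt hij
  have h5 : i ^ 5 ≤ j ^ 5 := by gcongr
  have h6 : i ^ 6 ≤ j ^ 6 := by gcongr
  have h7 : (j - i) * j ^ 5 ≤ j ^ 6 - i ^ 6 := by nlinarith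
  have h8 : 0 < (j - i) * j ^ 5 := mul_pos (by linarith) (by positivity)
  have key : j ^ 6 / (j ^ 6 - i ^ 6) ≤ j / (j - i) := by
    rw [div_le_div_iff₀ (by linarith) (by linarith)]
    calc j ^ 6 * (j - i) = j * ((j - i) * j ^ 5) := by ring
      _ ≤ _ := by gcongr
  refine ⟨le_trans ?_ key, key⟩
  have : 0 < j ^ 6 - i ^ 6 := by linarith
  gcongr

lemma div_sub_one_le {j k : ℝ} (hk : 0 ≤ k) (h : k + 2 ≤ j) :
    j / (j - (k + 1)) ≤ 3 * ((k + j) / (1 + |k - j|)) := by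
  rw [abs_of_nonpos (by linarith), ← mul_div_assoc, div_le_div_iff₀ (by linarith) (by linarith)]
  nlinarith

/-- The energy on a block where `-1 / (2 φ')` lies between `k ^ 6` and `(k + 1) ^ 6`. -/
lemma energy_block_le {φ p q : ℝ → ℝ} {α β ε D : ℝ} {k : ℕ} (H : IsC2Phase φ p q α β)
    (hαβ : α ≤ β) (hε : |ε| = 1) (hq : ∀ x ∈ Set.Icc α β, 0 ≤ ε * q x) (hk : 1 ≤ k)
    (hD : 1 ≤ D) (hlen1 : β - α ≤ 1) (hlen : β - α ≤ D / (k : ℝ) ^ 4)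
    (hp : ∀ x ∈ Set.Icc α β, 1 / (2 * ((k : ℝ) + 1) ^ 6) ≤ -p x ∧ -p x ≤ 1 / (2 * (k : ℝ) ^ 6))
    {r : ℕ → ℕ} (hr : ∀ n, r n ^ 6 ≤ n ∧ n < (r n + 1) ^ 6) {N : ℕ} (a : ℕ → ℂ) :
    energy φ a (Finset.Icc 1 N) α β ≤ ∑ n ∈ Finset.Icc 1 N,
      3400 * D * (1 + Real.log N) * (((k : ℝ) + r n) / (1 + |(k : ℝ) - r n|)) * ‖a n‖ ^ 2 := by
  set W : ℕ → ℝ := fun n => ((k : ℝ) + r n) / (1 + |(k : ℝ) - r n|) with hW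
  have hkR : (1 : ℝ) ≤ k := by exact_mod_cast hk
  have hL : 0 ≤ Real.log N := Real.log_natCast_nonneg N
  have hr1 : ∀ n ∈ Finset.Icc 1 N, (1 : ℝ) ≤ r n := fun n hn => by
    have h1 := (hr n).2
    have h2 := (Finset.mem_Icc.1 hn).1
    have : r n ≠ 0 := fun h0 => by rw [h0] at h1; omega
    exact_mod_cast Nat.one_le_iff_ne_zero.2 this
  have hW1 : ∀ n ∈ Finset.Icc 1 N, 1 ≤ W n := fun n hn => by
    have := hr1 n hn
    simp only [hW]
    rw [one_le_div (by positivity)]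
    have : |(k : ℝ) - r n| ≤ k + r n - 1 := abs_le.2 ⟨by linarith, by linarith⟩
    linarith
  have hrange : ∀ T ⊆ Finset.Icc 1 N, T ⊆ Finset.range (N + 1) := fun T hT n hn => by
    have := Finset.mem_Icc.1 (hT hn)
    exact Finset.mem_range.2 (by omega)
  set U := (Finset.Icc 1 N).filter (fun n => k + 2 ≤ r n) with hU
  set V := (Finset.Icc 1 N).filter (fun n => r n + 2 ≤ k) with hV
  set Z := (Finset.Icc 1 N).filter (fun n => k < r n + 2 ∧ r n < k + 2) with hZ
  have hUS : U ⊆ Finset.Icc 1 N := Finset.filter_subset _ _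
  have hVS : V ⊆ Finset.Icc 1 N := Finset.filter_subset _ _
  have hZS : Z ⊆ Finset.Icc 1 N := Finset.filter_subset _ _
  have hdUV : Disjoint U V := by
    rw [Finset.disjoint_left]
    intro n hn hn'
    simp only [hU, hV, Finset.mem_filter] at hn hn'
    omega
  have hdZ : Disjoint Z (U ∪ V) := by
    rw [Finset.disjoint_left]
    intro n hn hn'
    simp only [hU, hV, hZ, Finset.mem_filter, Finset.mem_union] at hn hn'
    omega
  have hunion : Finset.Icc 1 N = Z ∪ (U ∪ V) := by
    ext n
    simp only [hU, hV, hZ, Finset.mem_filter, Finset.mem_union]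
    constructor
    · intro h
      simp only [h, true_and]
      omega
    · tauto
  have hEU : energy φ a U α β ≤ ∑ n ∈ U, 25 * (1 + Real.log N) * W n * ‖a n‖ ^ 2 := by
    have hn6 : ∀ n ∈ U, ((k : ℝ) + 1) ^ 6 < (r n : ℝ) ^ 6 ∧ (r n : ℝ) ^ 6 ≤ n ∧
        (k : ℝ) + 2 ≤ r n := by
      intro n hn
      have h0 : (k : ℝ) + 2 ≤ r n := by exact_mod_cast (Finset.mem_filter.1 hn).2
      refine ⟨?_, by exact_mod_cast (hr n).1, h0⟩
      gcongr
      linarith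
    refine (energy_le_of_le_abs_deriv H hαβ hε hq (hrange U hUS) (t := ((k : ℝ) + 1) ^ 6)
      (by positivity) (fun n => (n : ℝ) - ((k : ℝ) + 1) ^ 6)
      (fun n hn => by linarith [(hn6 n hn).1, (hn6 n hn).2.1]) ?_ a).trans ?_
    · intro n hn m hm x hx
      have h1 := (hp x hx).1
      refine le_trans ?_ (neg_le_abs _)
      have h2 : ((n : ℝ) + m) * (1 / (2 * ((k : ℝ) + 1) ^ 6)) ≤ ((n : ℝ) + m) * -p x := by gcongr
      have h3 : ((n : ℝ) - ((k : ℝ) + 1) ^ 6 + (m - ((k : ℝ) + 1) ^ 6)) / (2 * ((k : ℝ) + 1) ^ 6)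
          = ((n : ℝ) + m) * (1 / (2 * ((k : ℝ) + 1) ^ 6)) - 1 := by
        field_simp
        ring
      rw [h3]
      linarith
    · refine Finset.sum_le_sum fun n hn => ?_
      obtain ⟨h1, h2, h3⟩ := hn6 n hn
      have h4 : ((k : ℝ) + 1) ^ 6 / ((n : ℝ) - ((k : ℝ) + 1) ^ 6) ≤ 3 * W n :=
        calc _ ≤ ((k : ℝ) + 1) ^ 6 / ((r n : ℝ) ^ 6 - ((k : ℝ) + 1) ^ 6) := by
              have : 0 < (r n : ℝ) ^ 6 - ((k : ℝ) + 1) ^ 6 := by linarith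
              gcongr
          _ ≤ _ := (pow_six_div_sub_le (by positivity) (by linarith)).1
          _ ≤ _ := div_sub_one_le (by positivity) h3
      have h5 := hW1 n (hUS hn)
      gcongr
      calc _ ≤ 1 + 8 * (1 + Real.log N) * (3 * W n) := by gcongr
        _ ≤ _ := by nlinarith
  have hEV : energy φ a V α β ≤ ∑ n ∈ V, 25 * (1 + Real.log N) * W n * ‖a n‖ ^ 2 := by
    have hn6 : ∀ n ∈ V, ((r n : ℝ) + 1) ^ 6 < (k : ℝ) ^ 6 ∧ (n : ℝ) ≤ ((r n : ℝ) + 1) ^ 6 ∧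
        (r n : ℝ) + 2 ≤ k := by
      intro n hn
      have h0 : (r n : ℝ) + 2 ≤ k := by exact_mod_cast (Finset.mem_filter.1 hn).2
      refine ⟨?_, by exact_mod_cast (hr n).2.le, h0⟩
      gcongr
      linarith
    refine (energy_le_of_le_abs_deriv H hαβ hε hq (hrange V hVS) (t := (k : ℝ) ^ 6)
      (by positivity) (fun n => (k : ℝ) ^ 6 - n)
      (fun n hn => by linarith [(hn6 n hn).1, (hn6 n hn).2.1]) ?_ a).trans ?_
    · intro n hn m hm x hx
      have h1 := (hp x hx).2
      refine le_trans ?_ (le_abs_self _)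
      have h2 : ((n : ℝ) + m) * -p x ≤ ((n : ℝ) + m) * (1 / (2 * (k : ℝ) ^ 6)) := by gcongr
      have h3 : ((k : ℝ) ^ 6 - n + ((k : ℝ) ^ 6 - m)) / (2 * (k : ℝ) ^ 6)
          = 1 - ((n : ℝ) + m) * (1 / (2 * (k : ℝ) ^ 6)) := by
        field_simp
        ring
      rw [h3]
      linarith
    · refine Finset.sum_le_sum fun n hn => ?_
      obtain ⟨h1, h2, h3⟩ := hn6 n hn
      have h4 : (k : ℝ) ^ 6 / ((k : ℝ) ^ 6 - n) ≤ 3 * W n :=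
        calc _ ≤ (k : ℝ) ^ 6 / ((k : ℝ) ^ 6 - ((r n : ℝ) + 1) ^ 6) := by
              have : 0 < (k : ℝ) ^ 6 - ((r n : ℝ) + 1) ^ 6 := by linarith
              gcongr
          _ ≤ _ := (pow_six_div_sub_le (by positivity) (by linarith)).2
          _ ≤ _ := div_sub_one_le (by positivity) h3
          _ = _ := by simp only [hW]; rw [abs_sub_comm, add_comm (r n : ℝ)]
      have h5 := hW1 n (hVS hn)
      gcongr
      calc _ ≤ 1 + 8 * (1 + Real.log N) * (3 * W n) := by gcongr
        _ ≤ _ := by nlinarith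
  have hEZ : energy φ a Z α β ≤ ∑ n ∈ Z, 1600 * D * W n * ‖a n‖ ^ 2 := by
    have hcard : (Z.card : ℝ) ≤ 800 * (k : ℝ) ^ 5 := by
      have hsub : Z ⊆ Finset.Ico ((k - 1) ^ 6) ((k + 2) ^ 6) := by
        intro n hn
        have h0 := (Finset.mem_filter.1 hn).2
        rw [Finset.mem_Ico]
        constructor
        · exact (Nat.pow_le_pow_left (by omega) 6).trans (hr n).1
        · exact (hr n).2.trans_le (Nat.pow_le_pow_left (by omega) 6)
      have h1 := Finset.card_le_card hsub
      rw [Nat.card_Ico] at h1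
      obtain ⟨m, rfl⟩ : ∃ m, k = m + 1 := ⟨k - 1, by omega⟩
      have h2 : (m + 1 + 2) ^ 6 - (m + 1 - 1) ^ 6 ≤ 800 * (m + 1) ^ 5 := by
        rw [Nat.add_sub_cancel, Nat.sub_le_iff_le_add]
        ring_nf
        nlinarith [Nat.zero_le m, Nat.zero_le (m ^ 2), Nat.zero_le (m ^ 3), Nat.zero_le (m ^ 4),
          Nat.zero_le (m ^ 5), Nat.zero_le (m ^ 6)]
      exact_mod_cast h1.trans h2
    refine (energy_le_card hαβ a Z).trans ?_
    rw [Finset.mul_sum]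
    refine Finset.sum_le_sum fun n hn => mul_le_mul_of_nonneg_right ?_ (sq_nonneg _)
    have h0 := (Finset.mem_filter.1 hn).2
    have hkW : (k : ℝ) ≤ 2 * W n := by
      have ha : (k : ℝ) ≤ r n + 1 := by exact_mod_cast (show k ≤ r n + 1 by omega)
      have hb : (r n : ℝ) ≤ k + 1 := by exact_mod_cast (show r n ≤ k + 1 by omega)
      have hc : |(k : ℝ) - r n| ≤ 1 := abs_le.2 ⟨by linarith, by linarith⟩
      simp only [hW]
      rw [← mul_div_assoc, le_div_iff₀ (by positivity)]
      have : (0 : ℝ) ≤ r n := by positivity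
      nlinarith
    calc (β - α) * Z.card ≤ (D / (k : ℝ) ^ 4) * (800 * (k : ℝ) ^ 5) :=
          mul_le_mul hlen hcard (Nat.cast_nonneg _) (by positivity)
      _ = 800 * D * k := by
          rw [div_mul_eq_mul_div, div_eq_iff (by positivity)]
          ring
      _ ≤ 800 * D * (2 * W n) := mul_le_mul_of_nonneg_left hkW (by positivity)
      _ = _ := by ring
  have h1 := energy_union_le hαβ H.cont a hdZ
  have h2 := energy_union_le hαβ H.cont a hdUV
  rw [← hunion] at h1
  have hbd : energy φ a (Finset.Icc 1 N) α β ≤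
      2 * (∑ n ∈ Z, 1600 * D * W n * ‖a n‖ ^ 2) +
      4 * (∑ n ∈ U ∪ V, 25 * (1 + Real.log N) * W n * ‖a n‖ ^ 2) := by
    rw [Finset.sum_union hdUV]
    linarith
  refine hbd.trans ?_
  conv_rhs => rw [hunion, Finset.sum_union hdZ]
  rw [Finset.mul_sum, Finset.mul_sum]
  have hsq : ∀ n, 0 ≤ ‖a n‖ ^ 2 := fun n => by positivity
  refine add_le_add (Finset.sum_le_sum fun n hn => ?_) (Finset.sum_le_sum fun n hn => ?_)
  · have h5 := hW1 n (hZS hn)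
    calc 2 * (1600 * D * W n * ‖a n‖ ^ 2) = (3200 * D * 1) * W n * ‖a n‖ ^ 2 := by ring
      _ ≤ (3400 * D * (1 + Real.log N)) * W n * ‖a n‖ ^ 2 := by
          gcongr
          · norm_num
          · linarith
  · have h5 := hW1 n (Finset.union_subset hUS hVS hn)
    calc 4 * (25 * (1 + Real.log N) * W n * ‖a n‖ ^ 2)
        = (100 * 1) * (1 + Real.log N) * W n * ‖a n‖ ^ 2 := by ring
      _ ≤ (3400 * D) * (1 + Real.log N) * W n * ‖a n‖ ^ 2 := by
          gcongr
          norm_num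

lemma IsC2Phase.slope_bounds {φ p q : ℝ → ℝ} {δ c₁ c₂ : ℝ} (H : IsC2Phase φ p q 0 δ)
    (hc₁ : 0 < c₁) (hc₂ : 0 < c₂)
    (hq : ∀ x ∈ Set.Icc 0 δ, c₁ * x ≤ -q x ∧ -q x ≤ c₂ * x) {x y : ℝ} (hx : 0 ≤ x)
    (hxy : x ≤ y) (hy : y ≤ δ) :
    c₁ * x * (y - x) ≤ p x - p y ∧ p x - p y ≤ c₂ * y * (y - x) := by
  rcases hxy.eq_or_lt with rfl | hlt
  · simp
  obtain ⟨z, hz, hzq⟩ := exists_hasDerivAt_eq_slope p q hlt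
    (H.cont_deriv.mono (Set.Icc_subset_Icc hx hy))
    fun z hz => H.hasDerivAt_deriv z ⟨hx.trans_lt hz.1, hz.2.trans_le hy⟩
  have hpos : 0 < y - x := by linarith
  rw [eq_div_iff hpos.ne'] at hzq
  have hb := hq z ⟨hx.trans hz.1.le, hz.2.le.trans hy⟩
  have h1 : c₁ * x ≤ -q z := le_trans (by gcongr; exact hz.1.le) hb.1
  have h2 : -q z ≤ c₂ * y := le_trans hb.2 (by gcongr; exact hz.2.le)
  constructor <;> nlinarith

/-- Points where `-1 / (2 φ')` takes the values `k ^ 6`, with control of the gaps. -/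
lemma exists_partition_of_deriv_neg {φ p q : ℝ → ℝ} {δ c₁ c₂ : ℝ} (H : IsC2Phase φ p q 0 δ)
    (hδ : 0 < δ) (hp0 : p 0 = 0) (hc₁ : 0 < c₁) (hc₂ : 0 < c₂)
    (hq : ∀ x ∈ Set.Icc 0 δ, c₁ * x ≤ -q x ∧ -q x ≤ c₂ * x) :
    ∃ (k₀ : ℕ) (X : ℕ → ℝ) (D : ℝ), 1 ≤ k₀ ∧ 1 ≤ D ∧
      (∀ k, k₀ ≤ k → 0 < X k ∧ X k ≤ δ ∧ -p (X k) = 1 / (2 * (k : ℝ) ^ 6)) ∧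
      (∀ k, k₀ ≤ k → X (k + 1) ≤ X k) ∧
      ∀ k, k₀ ≤ k → X k - X (k + 1) ≤ D / (k : ℝ) ^ 4 := by
  have slope := fun {x y : ℝ} => H.slope_bounds (x := x) (y := y) hc₁ hc₂ hq
  have hδp : 0 < -p δ := by
    have h1 := (slope (x := δ / 2) (y := δ) (by linarith) (by linarith) le_rfl).1
    have h2 := (slope (x := 0) (y := δ / 2) le_rfl (by linarith) (by linarith)).1
    rw [hp0] at h2
    have : 0 < c₁ * (δ / 2) * (δ - δ / 2) := by
      have : 0 < δ - δ / 2 := by linarith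
      positivity
    linarith
  obtain ⟨k₀, hk₀1, hk₀⟩ : ∃ k₀ : ℕ, 1 ≤ k₀ ∧ 1 / (2 * (k₀ : ℝ) ^ 6) ≤ -p δ := by
    obtain ⟨m, hm⟩ := exists_nat_ge (1 / -p δ)
    refine ⟨m + 1, by omega, ?_⟩
    rw [div_le_iff₀ hδp] at hm
    rw [div_le_iff₀ (by positivity)]
    have h1 : (m : ℝ) ≤ 2 * ((m + 1 : ℕ) : ℝ) ^ 6 := by
      have : (m + 1) ≤ (m + 1) ^ 6 := Nat.le_self_pow (by norm_num) _
      exact_mod_cast (show m ≤ 2 * (m + 1) ^ 6 by omega)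
    nlinarith
  have hex : ∀ k : ℕ, ∃ x, k₀ ≤ k → (0 < x ∧ x ≤ δ ∧ -p x = 1 / (2 * (k : ℝ) ^ 6)) := by
    intro k
    by_cases hk : k₀ ≤ k
    · have hkpos : (0 : ℝ) < k := by exact_mod_cast (show 0 < k by omega)
      have hkk : (k₀ : ℝ) ≤ k := by exact_mod_cast hk
      have hk0pos : (0 : ℝ) < k₀ := by exact_mod_cast (show 0 < k₀ by omega)
      have hle : 1 / (2 * (k : ℝ) ^ 6) ≤ -p δ := le_trans (by gcongr) hk₀
      obtain ⟨x, hx, hpx⟩ := intermediate_value_Icc hδ.le H.cont_deriv.neg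
        (show 1 / (2 * (k : ℝ) ^ 6) ∈ Set.Icc (-p 0) (-p δ) from
          ⟨by rw [hp0, neg_zero]; positivity, hle⟩)
      have hpx' : -p x = 1 / (2 * (k : ℝ) ^ 6) := hpx
      refine ⟨x, fun _ => ⟨?_, hx.2, hpx'⟩⟩
      rcases hx.1.eq_or_lt with h0 | h0
      · rw [← h0, hp0, neg_zero] at hpx'
        have : 0 < 1 / (2 * (k : ℝ) ^ 6) := by positivity
        linarith
      · exact h0
    · exact ⟨0, fun h => absurd h hk⟩
  choose X hX using hex
  have hanti : ∀ k, k₀ ≤ k → X (k + 1) ≤ X k := by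
    intro k hk
    by_contra! hlt
    obtain ⟨h1, h2, h3⟩ := hX k hk
    obtain ⟨h4, h5, h6⟩ := hX (k + 1) (by omega)
    have h7 := (slope h1.le hlt.le h5).1
    have hkpos : (0 : ℝ) < k := by exact_mod_cast (show 0 < k by omega)
    have h8 : 1 / (2 * ((k + 1 : ℕ) : ℝ) ^ 6) < 1 / (2 * (k : ℝ) ^ 6) := by
      push_cast
      gcongr
      linarith
    have h9 : 0 < c₁ * X k * (X (k + 1) - X k) := by
      have : 0 < X (k + 1) - X k := by linarith
      positivity
    linarith
  set D : ℝ := max 1 (12 * √(2 * c₂) / c₁) with hD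
  have hD1 : 1 ≤ D := le_max_left _ _
  have hlen : ∀ k, k₀ ≤ k → X k - X (k + 1) ≤ D / (k : ℝ) ^ 4 := by
    intro k hk
    obtain ⟨h1, h2, h3⟩ := hX k hk
    obtain ⟨h4, h5, h6⟩ := hX (k + 1) (by omega)
    have hk1 : (1 : ℝ) ≤ k := by exact_mod_cast hk₀1.trans hk
    have h7 := (slope h4.le (hanti k hk) h2).1
    have h8 := (slope (x := 0) le_rfl h4.le h5).2
    rw [hp0, zero_sub, sub_zero, h6] at h8
    push_cast at h6 h8
    set s := √(2 * c₂) with hs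
    have hs2 : s ^ 2 = 2 * c₂ := Real.sq_sqrt (by positivity)
    have hspos : 0 < s := Real.sqrt_pos.2 (by positivity)
    have h9 : 1 ≤ s * X (k + 1) * ((k : ℝ) + 1) ^ 3 := by
      rw [div_le_iff₀ (by positivity)] at h8
      have : 1 ≤ (s * X (k + 1) * ((k : ℝ) + 1) ^ 3) ^ 2 := by
        calc 1 ≤ c₂ * X (k + 1) * X (k + 1) * (2 * ((k : ℝ) + 1) ^ 6) := h8
          _ = (2 * c₂) * (X (k + 1)) ^ 2 * ((k : ℝ) + 1) ^ 6 := by ring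
          _ = _ := by rw [← hs2]; ring
      exact (one_le_sq_iff₀ (by positivity)).1 this
    have h10 : p (X (k + 1)) - p (X k) ≤ 3 / ((k : ℝ) ^ 6 * ((k : ℝ) + 1)) := by
      have : p (X (k + 1)) - p (X k) = 1 / (2 * (k : ℝ) ^ 6) - 1 / (2 * ((k : ℝ) + 1) ^ 6) := by
        linarith
      rw [this, div_sub_div _ _ (by positivity) (by positivity),
        div_le_div_iff₀ (by positivity) (by positivity)]
      have h11 : ((k : ℝ) + 1) ^ 6 - (k : ℝ) ^ 6 ≤ 6 * ((k : ℝ) + 1) ^ 5 := by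
        have hk0 : (0 : ℝ) ≤ k := by positivity
        nlinarith [pow_nonneg hk0 2, pow_nonneg hk0 3, pow_nonneg hk0 4, pow_nonneg hk0 5]
      calc _ = (((k : ℝ) + 1) ^ 6 - (k : ℝ) ^ 6) * (2 * (k : ℝ) ^ 6 * ((k : ℝ) + 1)) := by ring
        _ ≤ (6 * ((k : ℝ) + 1) ^ 5) * (2 * (k : ℝ) ^ 6 * ((k : ℝ) + 1)) := by gcongr
        _ = _ := by ring
    have h12 : X k - X (k + 1) ≤ (12 * s / c₁) / (k : ℝ) ^ 4 := by
      have hnn : 0 ≤ X k - X (k + 1) := by linarith [hanti k hk]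
      have h13 : c₁ * (X k - X (k + 1)) ≤ s * ((k : ℝ) + 1) ^ 3 *
          (3 / ((k : ℝ) ^ 6 * ((k : ℝ) + 1))) := by
        calc c₁ * (X k - X (k + 1)) = c₁ * (X k - X (k + 1)) * 1 := by ring
          _ ≤ c₁ * (X k - X (k + 1)) * (s * X (k + 1) * ((k : ℝ) + 1) ^ 3) := by gcongr
          _ = s * ((k : ℝ) + 1) ^ 3 * (c₁ * X (k + 1) * (X k - X (k + 1))) := by ring
          _ ≤ _ := by gcongr; exact h7.trans h10
      have h14 : s * ((k : ℝ) + 1) ^ 3 * (3 / ((k : ℝ) ^ 6 * ((k : ℝ) + 1)))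
          = 3 * s * ((k : ℝ) + 1) ^ 2 / (k : ℝ) ^ 6 := by
        field_simp
      have h15 : 3 * s * ((k : ℝ) + 1) ^ 2 / (k : ℝ) ^ 6 ≤ 12 * s / (k : ℝ) ^ 4 := by
        rw [div_le_div_iff₀ (by positivity) (by positivity)]
        have : ((k : ℝ) + 1) ^ 2 ≤ 4 * (k : ℝ) ^ 2 := by nlinarith
        calc _ ≤ 3 * s * (4 * (k : ℝ) ^ 2) * (k : ℝ) ^ 4 := by gcongr
          _ = _ := by ring
      rw [div_right_comm, le_div_iff₀ hc₁]
      linarith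
    exact h12.trans (by gcongr; exact le_max_right _ _)
  exact ⟨k₀, X, D, hk₀1, hD1, hX, hanti, hlen⟩

lemma sum_weight_le {k₀ K r : ℕ} (hr : r ≤ K) :
    ∑ k ∈ Finset.Ico k₀ K, ((k : ℝ) + r) / (1 + |(k : ℝ) - r|)
      ≤ 2 * K * (3 * (1 + Real.log K)) := by
  have hrn : (r : ℝ) ≤ K := by exact_mod_cast hr
  calc _ ≤ ∑ k ∈ Finset.Ico k₀ K, 2 * K * (1 / (1 + |(r : ℝ) - k|)) := by
        refine Finset.sum_le_sum fun k hk => ?_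
        have : (k : ℝ) ≤ K := by exact_mod_cast (Finset.mem_Ico.1 hk).2.le
        rw [abs_sub_comm, mul_one_div]
        gcongr
        linarith
    _ = 2 * K * ∑ k ∈ Finset.Ico k₀ K, 1 / (1 + |(r : ℝ) - k|) := by rw [Finset.mul_sum]
    _ ≤ _ := by
        gcongr
        refine sum_inv_one_add_abs_sub_le (fun k hk => ?_) hr
        have := Finset.mem_Ico.1 hk
        exact Finset.mem_range.2 (by omega)

/-- Bound near the degenerate critical point when `φ'` is negative on its right. -/
lemma exists_energy_le_of_deriv_neg {φ p q : ℝ → ℝ} {δ c₁ c₂ : ℝ} (H : IsC2Phase φ p q 0 δ)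
    (hδ : 0 < δ) (hδ1 : δ ≤ 1) (hp0 : p 0 = 0) (hc₁ : 0 < c₁) (hc₂ : 0 < c₂)
    (hq : ∀ x ∈ Set.Icc 0 δ, c₁ * x ≤ -q x ∧ -q x ≤ c₂ * x) :
    ∃ δ' > 0, δ' ≤ δ ∧ ∃ C > 0, ∀ N : ℕ, 1 ≤ N → ∀ a : ℕ → ℂ,
      energy φ a (Finset.Icc 1 N) 0 δ' ≤ C * (1 + Real.log N) ^ 2 * (N : ℝ) ^ ((1 : ℝ) / 6) *
        ∑ n ∈ Finset.Icc 1 N, ‖a n‖ ^ 2 := by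
  have slope := fun {x y : ℝ} => H.slope_bounds (x := x) (y := y) hc₁ hc₂ hq
  obtain ⟨k₀, X, D, hk₀1, hD1, hX, hanti, hlen⟩ :=
    exists_partition_of_deriv_neg H hδ hp0 hc₁ hc₂ hq
  choose r hr using exists_pow_six_le
  have hmono : ∀ {x y : ℝ}, 0 ≤ x → x ≤ y → y ≤ δ → -p x ≤ -p y := fun {x y} hx hxy hy => by
    have h1 := (slope hx hxy hy).1
    have : 0 ≤ c₁ * x * (y - x) := by
      have : 0 ≤ y - x := by linarith
      positivity
    linarith
  have hsign : ∀ x ∈ Set.Icc 0 δ, 0 ≤ (-1) * q x := fun x hx => by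
    have h1 := (hq x hx).1
    have h2 : 0 ≤ c₁ * x := mul_nonneg hc₁.le hx.1
    linarith
  have hε : |(-1 : ℝ)| = 1 := by norm_num
  have htel : ∀ (N : ℕ) (a : ℕ → ℂ) (K : ℕ), k₀ ≤ K → X K ≤ X k₀ ∧
      energy φ a (Finset.Icc 1 N) (X K) (X k₀) ≤ ∑ k ∈ Finset.Ico k₀ K, ∑ n ∈ Finset.Icc 1 N,
      3400 * D * (1 + Real.log N) * (((k : ℝ) + r n) / (1 + |(k : ℝ) - r n|)) * ‖a n‖ ^ 2 := by
    intro N a K hK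
    induction K, hK using Nat.le_induction with
    | base => simp [energy]
    | succ k hk ih =>
      obtain ⟨h1, h2, h3⟩ := hX k hk
      obtain ⟨h4, h5, h6⟩ := hX (k + 1) (by omega)
      have h7 := hanti k hk
      refine ⟨h7.trans ih.1, ?_⟩
      rw [energy_add_adjacent h7 ih.1 (H.cont.mono (Set.Icc_subset_Icc h4.le (hX k₀ le_rfl).2.1)),
        Finset.sum_Ico_succ_top hk, add_comm]
      refine add_le_add ih.2 (energy_block_le (H.mono h4.le h2) h7 hε
        (fun x hx => hsign x ⟨h4.le.trans hx.1, hx.2.trans h2⟩) (hk₀1.trans hk) hD1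
        (by linarith) (hlen k hk) (fun x hx => ?_) hr a)
      push_cast at h6
      rw [← h3, ← h6]
      exact ⟨hmono h4.le hx.1 (hx.2.trans h2), hmono (h4.le.trans hx.1) hx.2 h2⟩
  refine ⟨X k₀, (hX k₀ le_rfl).1, (hX k₀ le_rfl).2.1, ?_⟩
  set M : ℝ := (k₀ : ℝ) + 4 with hM
  have hMpos : 0 < M := by positivity
  have hM1 : 1 ≤ M := by
    have : (0 : ℝ) ≤ k₀ := by positivity
    linarith
  have hlogM : 0 ≤ Real.log M := Real.log_nonneg hM1
  refine ⟨17 + 3400 * D * (2 * M * (3 * (1 + Real.log M))), by positivity, fun N hN a => ?_⟩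
  set ν : ℝ := (N : ℝ) ^ ((1 : ℝ) / 6) with hν
  have hN1 : (1 : ℝ) ≤ N := by exact_mod_cast hN
  have hν1 : 1 ≤ ν := Real.one_le_rpow hN1 (by norm_num)
  have hν6 : ν ^ 6 = N := by
    rw [hν, ← Real.rpow_natCast, ← Real.rpow_mul (by positivity)]
    norm_num
  have hνN : ν ≤ N := by
    rw [← hν6]
    exact le_self_pow₀ hν1 (by norm_num)
  set L : ℝ := 1 + Real.log N with hL
  have hlogN : 0 ≤ Real.log N := Real.log_natCast_nonneg N
  have hL1 : 1 ≤ L := by linarith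
  set K : ℕ := k₀ + 2 * ⌈ν⌉₊ with hK
  have hceil := Nat.le_ceil ν
  have hceil' := (Nat.ceil_lt_add_one (show 0 ≤ ν by linarith)).le
  have hKcast : (K : ℝ) = k₀ + 2 * (⌈ν⌉₊ : ℝ) := by rw [hK]; push_cast; ring
  have hKν : 2 * ν ≤ K := by
    have : (0 : ℝ) ≤ k₀ := by positivity
    linarith
  have hKM : (K : ℝ) ≤ M * ν := by
    have : (0 : ℝ) ≤ k₀ := by positivity
    rw [hKcast, hM]
    nlinarith
  have hK6 : 2 * (N : ℝ) ≤ (K : ℝ) ^ 6 := by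
    calc 2 * (N : ℝ) ≤ 2 ^ 6 * N := by gcongr; norm_num
      _ = (2 * ν) ^ 6 := by rw [← hν6]; ring
      _ ≤ _ := by gcongr
  have hKpos : (0 : ℝ) < K := by linarith
  have hlogK : 1 + Real.log K ≤ (1 + Real.log M) * L := by
    have : Real.log K ≤ Real.log M + Real.log N := by
      rw [← Real.log_mul (by positivity) (by positivity)]
      apply Real.log_le_log hKpos
      exact hKM.trans (by gcongr)
    rw [hL]
    nlinarith
  have hrK : ∀ n ∈ Finset.Icc 1 N, r n ≤ K := by
    intro n hn
    have h1 : (r n) ^ 6 ≤ K ^ 6 := by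
      have h2 := (hr n).1
      have h3 := (Finset.mem_Icc.1 hn).2
      have h4 : 2 * N ≤ K ^ 6 := by exact_mod_cast hK6
      omega
    exact (Nat.pow_le_pow_iff_left (by norm_num)).1 h1
  obtain ⟨hXle, htelK⟩ := htel N a K (by omega)
  obtain ⟨h1, h2, h3⟩ := hX K (by omega)
  set A := ∑ n ∈ Finset.Icc 1 N, ‖a n‖ ^ 2 with hA
  have hA0 : 0 ≤ A := Finset.sum_nonneg fun _ _ => by positivity
  have hinner : energy φ a (Finset.Icc 1 N) 0 (X K) ≤ 17 * L * A := by
    refine (energy_le_of_le_abs_deriv (H.mono le_rfl h2) h1.le hε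
      (fun x hx => hsign x ⟨hx.1, hx.2.trans h2⟩) (N := N) (t := 2) ?_ (by norm_num) (fun _ => 1)
      (fun _ _ => one_pos) ?_ a).trans ?_
    · intro n hn
      have := Finset.mem_Icc.1 hn
      exact Finset.mem_range.2 (by omega)
    · intro n hn m hm x hx
      refine le_trans ?_ (le_abs_self _)
      have h4 : -p x ≤ 1 / (2 * (K : ℝ) ^ 6) := h3 ▸ hmono hx.1 hx.2 h2
      have hn' : (n : ℝ) ≤ N := by exact_mod_cast (Finset.mem_Icc.1 hn).2
      have hm' : (m : ℝ) ≤ N := by exact_mod_cast (Finset.mem_Icc.1 hm).2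
      have h5 : ((n : ℝ) + m) * -p x ≤ 1 / 2 := by
        calc ((n : ℝ) + m) * -p x ≤ ((n : ℝ) + m) * (1 / (2 * (K : ℝ) ^ 6)) := by gcongr
          _ ≤ (K : ℝ) ^ 6 * (1 / (2 * (K : ℝ) ^ 6)) := by gcongr; linarith
          _ = 1 / 2 := by field_simp
      linarith
    · rw [hA, Finset.mul_sum]
      refine Finset.sum_le_sum fun n _ => ?_
      gcongr
      rw [← hL]
      linarith
  have houter : energy φ a (Finset.Icc 1 N) (X K) (X k₀)
      ≤ 3400 * D * (2 * M * (3 * (1 + Real.log M))) * L ^ 2 * ν * A := by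
    refine htelK.trans ?_
    rw [Finset.sum_comm, hA, Finset.mul_sum]
    refine Finset.sum_le_sum fun n hn => ?_
    rw [← Finset.sum_mul, ← Finset.mul_sum]
    refine mul_le_mul_of_nonneg_right ?_ (sq_nonneg _)
    have h4 := sum_weight_le (k₀ := k₀) (hrK n hn)
    calc 3400 * D * L * ∑ k ∈ Finset.Ico k₀ K, ((k : ℝ) + r n) / (1 + |(k : ℝ) - r n|)
        ≤ 3400 * D * L * (2 * (M * ν) * (3 * ((1 + Real.log M) * L))) := by
          have hK0 : 0 ≤ Real.log K := Real.log_natCast_nonneg K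
          refine mul_le_mul_of_nonneg_left (h4.trans ?_) (by positivity)
          gcongr
      _ = _ := by ring
  rw [energy_add_adjacent h1.le hXle (H.cont.mono (Set.Icc_subset_Icc_right (hX k₀ le_rfl).2.1))]
  have : 17 * L * A ≤ 17 * L ^ 2 * ν * A := by
    have h4 : L * 1 ≤ L ^ 2 * ν :=
      mul_le_mul (le_self_pow₀ hL1 (by norm_num)) hν1 zero_le_one (by positivity)
    calc 17 * L * A = 17 * A * (L * 1) := by ring
      _ ≤ 17 * A * (L ^ 2 * ν) := mul_le_mul_of_nonneg_left h4 (by positivity)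
      _ = _ := by ring
  calc _ ≤ 17 * L ^ 2 * ν * A + 3400 * D * (2 * M * (3 * (1 + Real.log M))) * L ^ 2 * ν * A :=
        add_le_add (hinner.trans this) houter
    _ = _ := by ring

/-- Bound away from critical points of `φ`. -/
lemma exists_energy_le_of_deriv_ne_zero {φ p q : ℝ → ℝ} {α β : ℝ} (H : IsC2Phase φ p q α β)
    (hαβ : α ≤ β) (hlen : β - α ≤ 1) (hp : ∀ x ∈ Set.Icc α β, p x ≠ 0) :
    ∃ C > 0, ∀ N : ℕ, ∀ a : ℕ → ℂ,
      energy φ a (Finset.Icc 1 N) α β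
        ≤ C * (1 + Real.log N) * ∑ n ∈ Finset.Icc 1 N, ‖a n‖ ^ 2 := by
  obtain ⟨B₀, hB₀⟩ := isCompact_Icc.exists_bound_of_continuousOn (H.cont_deriv.inv₀ hp)
  obtain ⟨M₀, hM₀⟩ := isCompact_Icc.exists_bound_of_continuousOn H.cont_deriv₂
  set B : ℝ := max B₀ 1 with hB
  set M : ℝ := max M₀ 0 with hM
  have hBpos : 0 < B := lt_of_lt_of_le one_pos (le_max_right _ _)
  have hMnn : 0 ≤ M := le_max_right _ _
  have hpB : ∀ x ∈ Set.Icc α β, 1 / B ≤ |p x| := fun x hx => by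
    have h1 := (hB₀ x hx).trans (le_max_left _ 1)
    have h2 := abs_pos.2 (hp x hx)
    rw [Pi.inv_apply, norm_inv, Real.norm_eq_abs, ← hB] at h1
    rw [one_div]
    exact inv_le_of_inv_le₀ h2 h1
  have hqM : ∀ x ∈ Set.Icc α β, |q x| ≤ M := fun x hx => (hM₀ x hx).trans (le_max_left _ _)
  set s₀ : ℕ := ⌈2 * B⌉₊ with hs₀
  set w : ℝ := 2 + 2 * M * B with hw
  have hwpos : 0 < w := by positivity
  refine ⟨2 * s₀ + 2 * (1 + 2 * w), by positivity, fun N a => ?_⟩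
  have hL : 0 ≤ Real.log N := Real.log_natCast_nonneg N
  set S := (Finset.Icc 1 N).filter (fun n => n ≤ s₀) with hS
  set T := (Finset.Icc 1 N).filter (fun n => ¬ n ≤ s₀) with hT
  have hST : Disjoint S T := Finset.disjoint_filter_filter_not _ _ _
  have hun : S ∪ T = Finset.Icc 1 N := Finset.filter_union_filter_not_eq _ _
  set A := ∑ n ∈ Finset.Icc 1 N, ‖a n‖ ^ 2 with hA
  have hAS : ∑ n ∈ S, ‖a n‖ ^ 2 ≤ A := Finset.sum_le_sum_of_subset_of_nonneg
    (Finset.filter_subset _ _) fun _ _ _ => by positivity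
  have hAT : ∑ n ∈ T, ‖a n‖ ^ 2 ≤ A := Finset.sum_le_sum_of_subset_of_nonneg
    (Finset.filter_subset _ _) fun _ _ _ => by positivity
  have hA0 : 0 ≤ A := Finset.sum_nonneg fun _ _ => by positivity
  have h1 : energy φ a S α β ≤ s₀ * A := by
    have hcard : (S.card : ℝ) ≤ s₀ := by
      have hsub : S ⊆ Finset.Icc 1 s₀ := fun n hn => by
        have h := Finset.mem_filter.1 hn
        exact Finset.mem_Icc.2 ⟨(Finset.mem_Icc.1 h.1).1, h.2⟩
      have := Finset.card_le_card hsub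
      rw [Nat.card_Icc, Nat.add_sub_cancel] at this
      exact_mod_cast this
    refine (energy_le_card hαβ a S).trans ?_
    have h2 : (β - α) * (S.card : ℝ) ≤ 1 * s₀ :=
      mul_le_mul hlen hcard (Nat.cast_nonneg _) zero_le_one
    calc _ ≤ (1 * (s₀ : ℝ)) * A := mul_le_mul h2 hAS
            (Finset.sum_nonneg fun _ _ => by positivity) (by positivity)
      _ = _ := by ring
  have h2 : energy φ a T α β ≤ (1 + 2 * w) * (1 + Real.log N) * A := by
    refine (energy_le_of_kernel hαβ H.cont (S := T) (N := N) ?_ (fun _ => √w) ?_ a).trans ?_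
    · intro n hn
      have := Finset.mem_Icc.1 (Finset.mem_filter.1 hn).1
      exact Finset.mem_range.2 (by omega)
    · intro n hn m hm hnm
      rw [Real.mul_self_sqrt hwpos.le]
      have hbig : ∀ n ∈ T, 2 * B ≤ (n : ℝ) := fun n hn => by
        have h3 := (Finset.mem_filter.1 hn).2
        have h4 : (s₀ : ℝ) ≤ n := by exact_mod_cast (not_le.1 h3).le
        exact (Nat.le_ceil _).trans h4
      set s : ℝ := (n : ℝ) + m with hs
      have hsB : 2 * B ≤ s := by
        have h3 := hbig n hn
        have : (0 : ℝ) ≤ m := by positivity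
        linarith
      have hspos : 0 < s := by linarith
      have hg : ∀ x ∈ Set.Icc α β, s / (2 * B) ≤ |1 + s * p x| := fun x hx => by
        have h3 : s / B ≤ |s * p x| := by
          rw [abs_mul, abs_of_pos hspos, div_eq_mul_one_div]
          exact mul_le_mul_of_nonneg_left (hpB x hx) hspos.le
        have h4 : |s * p x| ≤ |1 + s * p x| + 1 := by
          have := abs_sub (1 + s * p x) 1
          rwa [add_sub_cancel_left, abs_one] at this
        have h5 : s / B = s / (2 * B) + s / (2 * B) := by field_simp; norm_num
        have h6 : 1 ≤ s / (2 * B) := by rwa [one_le_div (by positivity)]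
        linarith
      have hg1 : 1 ≤ s / (2 * B) := by rwa [one_le_div (by positivity)]
      refine (norm_integral_e_le (V := 2 * M * B) H hαβ
        (sub_ne_zero.2 (by exact_mod_cast hnm)) one_pos
        (fun x hx => hg1.trans (hg x hx)) ?_).trans (le_of_eq ?_)
      · have hb : ∀ x ∈ Set.Icc α β, |s * q x| / (1 + s * p x) ^ 2 ≤ 2 * M * B := fun x hx => by
          have h3 : (s / (2 * B)) ^ 2 ≤ (1 + s * p x) ^ 2 := by
            rw [← sq_abs (1 + s * p x)]
            exact pow_le_pow_left₀ (by positivity) (hg x hx) 2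
          have h4 : |s * q x| ≤ s * M := by
            rw [abs_mul, abs_of_pos hspos]
            exact mul_le_mul_of_nonneg_left (hqM x hx) hspos.le
          calc |s * q x| / (1 + s * p x) ^ 2 ≤ (s * M) / (s / (2 * B)) ^ 2 := by gcongr
            _ = 4 * M * B ^ 2 / s := by field_simp; norm_num
            _ ≤ 2 * M * B := by
                rw [div_le_iff₀ hspos]
                have : 0 ≤ 2 * M * B := by positivity
                nlinarith
        have h3 := intervalIntegral.norm_integral_le_of_norm_le_const (a := α) (b := β)
          (f := fun x => |s * q x| / (1 + s * p x) ^ 2) (C := 2 * M * B) fun x hx => by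
            rw [Set.uIoc_of_le hαβ] at hx
            rw [Real.norm_of_nonneg (by positivity)]
            exact hb x ⟨hx.1.le, hx.2⟩
        refine (le_abs_self _).trans (h3.trans ?_)
        rw [abs_of_nonneg (by linarith)]
        exact mul_le_of_le_one_right (by positivity) hlen
      · rw [div_one]
    · rw [Real.sq_sqrt hwpos.le, ← Finset.mul_sum]
      refine mul_le_mul ?_ hAT (Finset.sum_nonneg fun _ _ => by positivity) (by positivity)
      nlinarith
  have h3 := energy_union_le hαβ H.cont a hST
  rw [hun] at h3
  have h4 : (s₀ : ℝ) * A ≤ s₀ * (1 + Real.log N) * A := by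
    refine mul_le_mul_of_nonneg_right ?_ hA0
    exact le_mul_of_one_le_right (by positivity) (by linarith)
  calc _ ≤ 2 * (s₀ * (1 + Real.log N) * A) + 2 * ((1 + 2 * w) * (1 + Real.log N) * A) := by
        linarith
    _ = _ := by ring

/-- Bound near the degenerate critical point when `φ'` is positive on its right. -/
lemma energy_le_of_deriv_pos {φ p q : ℝ → ℝ} {δ : ℝ} (H : IsC2Phase φ p q 0 δ)
    (hδ : 0 < δ) (hδ1 : δ ≤ 1) (hp0 : p 0 = 0) (hq : ∀ x ∈ Set.Icc 0 δ, 0 ≤ q x)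
    (N : ℕ) (a : ℕ → ℂ) :
    energy φ a (Finset.Icc 1 N) 0 δ
      ≤ 9 * (1 + Real.log N) * ∑ n ∈ Finset.Icc 1 N, ‖a n‖ ^ 2 := by
  have hL : 0 ≤ Real.log N := Real.log_natCast_nonneg N
  have hp : ∀ x ∈ Set.Icc 0 δ, 0 ≤ p x := fun x hx => by
    rcases hx.1.eq_or_lt with rfl | h0
    · exact hp0.ge
    obtain ⟨z, hz, hzq⟩ := exists_hasDerivAt_eq_slope p q h0
      (H.cont_deriv.mono (Set.Icc_subset_Icc_right hx.2))
      fun z hz => H.hasDerivAt_deriv z ⟨hz.1, hz.2.trans_le hx.2⟩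
    have h1 := hq z ⟨hz.1.le, hz.2.le.trans hx.2⟩
    rw [hzq, hp0, sub_zero, sub_zero] at h1
    by_contra! hneg
    have := div_neg_of_neg_of_pos hneg h0
    linarith
  refine (energy_le_of_le_abs_deriv H hδ.le (ε := 1) (by norm_num)
    (fun x hx => by linarith [hq x hx]) (N := N) (t := 1) ?_ one_pos (fun _ => 1)
    (fun _ _ => one_pos) ?_ a).trans ?_
  · intro n hn
    have := Finset.mem_Icc.1 hn
    exact Finset.mem_range.2 (by omega)
  · intro n _ m _ x hx
    refine le_trans ?_ (le_abs_self _)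
    have : 0 ≤ ((n : ℝ) + m) * p x := mul_nonneg (by positivity) (hp x hx)
    linarith
  · rw [Finset.mul_sum]
    refine Finset.sum_le_sum fun n _ => mul_le_mul_of_nonneg_right ?_ (sq_nonneg _)
    linarith

/-- The one-sided energy bound. -/
lemma exists_energy_le {φ p q : ℝ → ℝ} {c : ℝ} (H : IsC2Phase φ p q 0 1) (hp0 : p 0 = 0)
    (hp : ∀ x ∈ Set.Ioc (0 : ℝ) 1, p x ≠ 0) (hq0 : q 0 = 0)
    (hqc : HasDerivWithinAt q c (Set.Ioi 0) 0) (hc : c ≠ 0) :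
    ∃ C > 0, ∀ N : ℕ, 1 ≤ N → ∀ a : ℕ → ℂ,
      energy φ a (Finset.Icc 1 N) 0 1 ≤ C * (1 + Real.log N) ^ 2 * (N : ℝ) ^ ((1 : ℝ) / 6) *
        ∑ n ∈ Finset.Icc 1 N, ‖a n‖ ^ 2 := by
  have hfac : ∀ N : ℕ, 1 ≤ N →
      1 + Real.log N ≤ (1 + Real.log N) ^ 2 * (N : ℝ) ^ ((1 : ℝ) / 6) := fun N hN => by
    have hL : 0 ≤ Real.log N := Real.log_natCast_nonneg N
    have h1 : (1 : ℝ) ≤ (N : ℝ) ^ ((1 : ℝ) / 6) :=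
      Real.one_le_rpow (by exact_mod_cast hN) (by norm_num)
    calc 1 + Real.log N = (1 + Real.log N) * 1 := by ring
      _ ≤ _ := mul_le_mul (le_self_pow₀ (by linarith) (by norm_num)) h1 zero_le_one
          (by positivity)
  have hslope : Filter.Tendsto (fun x => q x / x) (nhdsWithin 0 (Set.Ioi 0)) (nhds c) := by
    rw [hasDerivWithinAt_iff_tendsto_slope' (by simp)] at hqc
    refine hqc.congr fun x => ?_
    rw [slope_def_field, hq0, sub_zero, sub_zero]
  have hnear : ∃ δ > 0, δ ≤ 1 ∧ ∃ C > 0, ∀ N : ℕ, 1 ≤ N → ∀ a : ℕ → ℂ,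
      energy φ a (Finset.Icc 1 N) 0 δ ≤ C * (1 + Real.log N) ^ 2 * (N : ℝ) ^ ((1 : ℝ) / 6) *
        ∑ n ∈ Finset.Icc 1 N, ‖a n‖ ^ 2 := by
    rcases lt_or_gt_of_ne hc with hneg | hpos
    · have hev := hslope.eventually
        (Ioo_mem_nhds (show 2 * c < c by linarith) (show c < c / 2 by linarith))
      obtain ⟨u, hu0, hu⟩ := mem_nhdsGT_iff_exists_Ioc_subset.1 hev
      have hu0' : 0 < u := hu0
      have hδ : 0 < min u 1 := lt_min hu0' one_pos
      obtain ⟨δ', h1, h2, C, hC, h3⟩ := exists_energy_le_of_deriv_neg (c₁ := -c / 2)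
        (c₂ := -(2 * c)) (H.mono le_rfl (min_le_right u 1)) hδ (min_le_right _ _) hp0
        (by linarith) (by linarith) (fun x hx => by
          rcases hx.1.eq_or_lt with rfl | h0
          · simp [hq0]
          · have h := hu ⟨h0, hx.2.trans (min_le_left _ _)⟩
            have h1 : 2 * c * x < q x := (lt_div_iff₀ h0).1 h.1
            have h2 : q x < c / 2 * x := (div_lt_iff₀ h0).1 h.2
            constructor <;> linarith)
      exact ⟨δ', h1, h2.trans (min_le_right _ _), C, hC, h3⟩
    · have hev := hslope.eventually (Ioi_mem_nhds hpos)
      obtain ⟨u, hu0, hu⟩ := mem_nhdsGT_iff_exists_Ioc_subset.1 hev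
      have hu0' : 0 < u := hu0
      have hδ : 0 < min u 1 := lt_min hu0' one_pos
      refine ⟨min u 1, hδ, min_le_right _ _, 9, by norm_num, fun N hN a => ?_⟩
      refine (energy_le_of_deriv_pos (H.mono le_rfl (min_le_right u 1)) hδ (min_le_right _ _) hp0
        (fun x hx => ?_) N a).trans ?_
      · rcases hx.1.eq_or_lt with rfl | h0
        · exact hq0.ge
        · have h : 0 < q x / x := hu ⟨h0, hx.2.trans (min_le_left _ _)⟩
          have h1 := mul_pos h h0
          rw [div_mul_cancel₀ _ h0.ne'] at h1
          exact h1.le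
      · rw [mul_assoc 9 ((1 + Real.log (N : ℝ)) ^ 2)]
        have := hfac N hN
        gcongr
  obtain ⟨δ, hδ, hδ1, C₁, hC₁, h1⟩ := hnear
  obtain ⟨C₂, hC₂, h2⟩ := exists_energy_le_of_deriv_ne_zero (H.mono hδ.le le_rfl) hδ1
    (by linarith) fun x hx => hp x ⟨hδ.trans_le hx.1, hx.2⟩
  refine ⟨C₁ + C₂, by positivity, fun N hN a => ?_⟩
  rw [energy_add_adjacent hδ.le hδ1 H.cont]
  have h3 : C₂ * (1 + Real.log N) * ∑ n ∈ Finset.Icc 1 N, ‖a n‖ ^ 2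
      ≤ C₂ * ((1 + Real.log N) ^ 2 * (N : ℝ) ^ ((1 : ℝ) / 6)) *
        ∑ n ∈ Finset.Icc 1 N, ‖a n‖ ^ 2 := by
    have := hfac N hN
    gcongr
  calc _ ≤ _ := add_le_add (h1 N hN a) ((h2 N a).trans h3)
    _ = _ := by ring

lemma energy_neg_eq (φ : ℝ → ℝ) (a : ℕ → ℂ) (S : Finset ℕ) (α β : ℝ) :
    energy φ a S (-β) (-α)
      = energy (fun x => -φ (-x)) (fun n => (starRingEnd ℂ) (a n)) S α β := by
  rw [energy, energy, ← intervalIntegral.integral_comp_neg]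
  refine intervalIntegral.integral_congr fun x _ => ?_
  have : ∑ n ∈ S, wave (fun x => -φ (-x)) (fun n => (starRingEnd ℂ) (a n)) n x
      = (starRingEnd ℂ) (∑ n ∈ S, wave φ a n (-x)) := by
    rw [map_sum]
    refine Finset.sum_congr rfl fun n _ => ?_
    rw [wave, wave, map_mul, star_e]
    congr 2
    ring
  simp only [this, RCLike.norm_conj]

lemma IsC2Phase.neg_comp_neg {φ p q : ℝ → ℝ} {α β : ℝ} (H : IsC2Phase φ p q (-β) (-α)) :
    IsC2Phase (fun x => -φ (-x)) (fun x => p (-x)) (fun x => -q (-x)) α β := by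
  have hmaps : Set.MapsTo (fun x : ℝ => -x) (Set.Icc α β) (Set.Icc (-β) (-α)) :=
    fun x hx => ⟨neg_le_neg hx.2, neg_le_neg hx.1⟩
  have hmaps' : ∀ x ∈ Set.Ioo α β, -x ∈ Set.Ioo (-β) (-α) :=
    fun x hx => ⟨neg_lt_neg hx.2, neg_lt_neg hx.1⟩
  refine ⟨(H.cont.comp continuousOn_neg hmaps).neg, H.cont_deriv.comp continuousOn_neg hmaps,
    (H.cont_deriv₂.comp continuousOn_neg hmaps).neg, fun x hx => ?_, fun x hx => ?_⟩
  · have := ((H.hasDerivAt (-x) (hmaps' x hx)).comp x (hasDerivAt_neg x)).neg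
    exact this.congr_deriv (by ring)
  · have := (H.hasDerivAt_deriv (-x) (hmaps' x hx)).comp x (hasDerivAt_neg x)
    exact this.congr_deriv (by ring)

lemma eLpNorm_sum_wave_le {φ : ℝ → ℝ} {α β B : ℝ} (hαβ : α ≤ β)
    (hφ : ContinuousOn φ (Set.Icc α β)) (a : ℕ → ℂ) (S : Finset ℕ) (hB : 0 ≤ B)
    (h : energy φ a S α β ≤ B ^ 2) :
    eLpNorm (fun x => ∑ n ∈ S, wave φ a n x) 2 (volume.restrict (Set.Ioo α β))
      ≤ ENNReal.ofReal B := by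
  have hmeas : AEStronglyMeasurable (fun x => ∑ n ∈ S, wave φ a n x)
      (volume.restrict (Set.Ioo α β)) :=
    ((continuousOn_sum_wave hφ a S).mono Set.Ioo_subset_Icc_self).aestronglyMeasurable
      measurableSet_Ioo
  have hmem : MemLp (fun x => ∑ n ∈ S, wave φ a n x) 2 (volume.restrict (Set.Ioo α β)) :=
    MemLp.of_bound hmeas (∑ n ∈ S, ‖a n‖) (Filter.Eventually.of_forall fun x =>
      (norm_sum_le _ _).trans (le_of_eq (Finset.sum_congr rfl fun n _ => norm_wave φ a n x)))
  rw [hmem.eLpNorm_eq_integral_rpow_norm (by norm_num) (by norm_num)]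
  apply ENNReal.ofReal_le_ofReal
  have hE : ∫ x in Set.Ioo α β, ‖∑ n ∈ S, wave φ a n x‖ ^ (2 : ENNReal).toReal
      = energy φ a S α β := by
    rw [energy, intervalIntegral.integral_of_le hαβ, integral_Ioc_eq_integral_Ioo]
    simp
  rw [hE]
  have hnn : 0 ≤ energy φ a S α β :=
    intervalIntegral.integral_nonneg hαβ fun x _ => by positivity
  calc energy φ a S α β ^ ((2 : ENNReal).toReal)⁻¹ = √(energy φ a S α β) := by
        rw [Real.sqrt_eq_rpow]; norm_num
    _ ≤ √(B ^ 2) := Real.sqrt_le_sqrt h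
    _ = B := Real.sqrt_sq hB

/-- **Remark (case `k = 3` for general phases).** Let `φ` be `C⁴` on `[-1,1]` with
`φ'(0) = φ''(0) = 0`, `φ'''(0) ≠ 0`, and `φ'(x) ≠ 0` for `x ≠ 0`. Then there are `C > 0`
and `A ≥ 0`, depending only on `φ`, such that for every `N ≥ 2` and all
`(a_n)_{n=1}^N`,
`‖∑_{n=1}^N a_n e(nx + n²φ(x))‖_{L²(-1,1)} ≤ C (log N)^A N^{1/12} (∑ |a_n|²)^{1/2}`. -/
theorem stmt19 (φ : ℝ → ℝ)
    (hφ : ContDiffOn ℝ 4 φ (Set.Icc (-1) 1))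
    (h1 : iteratedDerivWithin 1 φ (Set.Icc (-1) 1) 0 = 0)
    (h2 : iteratedDerivWithin 2 φ (Set.Icc (-1) 1) 0 = 0)
    (h3 : iteratedDerivWithin 3 φ (Set.Icc (-1) 1) 0 ≠ 0)
    (h4 : ∀ x ∈ Set.Icc (-1:ℝ) 1, x ≠ 0 → derivWithin φ (Set.Icc (-1) 1) x ≠ 0) :
    ∃ C > 0, ∃ A : ℝ, 0 ≤ A ∧ ∀ N : ℕ, 2 ≤ N → ∀ a : ℕ → ℂ,
      eLpNorm (fun x : ℝ =>
          ∑ n ∈ Finset.Icc 1 N, a n * e ((n:ℝ) * x + (n:ℝ)^2 * φ x)) 2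
        (volume.restrict (Set.Ioo (-1) 1))
      ≤ ENNReal.ofReal
          (C * Real.log N ^ A * (N:ℝ) ^ ((1:ℝ)/12) *
            Real.sqrt (∑ n ∈ Finset.Icc 1 N, ‖a n‖^2)) := by
  set I := Set.Icc (-1 : ℝ) 1 with hI
  have hu : UniqueDiffOn ℝ I := uniqueDiffOn_Icc (by norm_num)
  have hderiv : ∀ k : ℕ, k < 4 → ∀ x ∈ Set.Ioo (-1 : ℝ) 1,
      HasDerivAt (iteratedDerivWithin k φ I) (iteratedDerivWithin (k + 1) φ I x) x := by
    intro k hk x hx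
    have h := (hφ.differentiableOn_iteratedDerivWithin (m := k) (by exact_mod_cast hk) hu x
      (Set.Ioo_subset_Icc_self hx)).hasDerivWithinAt
    rw [← iteratedDerivWithin_succ] at h
    exact h.hasDerivAt (Icc_mem_nhds hx.1 hx.2)
  have hcont : ∀ k : ℕ, k ≤ 4 → ContinuousOn (iteratedDerivWithin k φ I) I := fun k hk =>
    hφ.continuousOn_iteratedDerivWithin (by exact_mod_cast hk) hu
  set p := iteratedDerivWithin 1 φ I with hp
  set q := iteratedDerivWithin 2 φ I with hq
  have H : IsC2Phase φ p q (-1) 1 :=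
    ⟨hφ.continuousOn, hcont 1 (by norm_num), hcont 2 (by norm_num),
      fun x hx => by simpa only [iteratedDerivWithin_zero] using hderiv 0 (by norm_num) x hx,
      fun x hx => hderiv 1 (by norm_num) x hx⟩
  have hqd : HasDerivAt q (iteratedDerivWithin 3 φ I 0) 0 :=
    hderiv 2 (by norm_num) 0 (by norm_num)
  have hpne : ∀ x ∈ I, x ≠ 0 → p x ≠ 0 := fun x hx hx0 => by
    rw [hp, iteratedDerivWithin_one]
    exact h4 x hx hx0
  obtain ⟨C₁, hC₁, hE₁⟩ := exists_energy_le (H.mono (by norm_num) le_rfl) h1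
    (fun x hx => hpne x ⟨by linarith [hx.1], hx.2⟩ hx.1.ne') h2 hqd.hasDerivWithinAt h3
  have H' : IsC2Phase φ p q (-1) (-0) := H.mono le_rfl (by norm_num)
  have hqd' : HasDerivAt (fun x => -q (-x)) (iteratedDerivWithin 3 φ I 0) 0 := by
    have h0 : HasDerivAt q (iteratedDerivWithin 3 φ I 0) (-0) := by rwa [neg_zero]
    exact (h0.comp 0 (hasDerivAt_neg 0)).neg.congr_deriv (by ring)
  obtain ⟨C₂, hC₂, hE₂⟩ := exists_energy_le H'.neg_comp_neg (by simpa using h1)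
    (fun x hx => hpne (-x) ⟨by linarith [hx.2], by linarith [hx.1]⟩ (neg_ne_zero.2 hx.1.ne'))
    (by simpa using h2) hqd'.hasDerivWithinAt h3
  refine ⟨3 * √(C₁ + C₂), by positivity, 1, zero_le_one, fun N hN a => ?_⟩
  refine eLpNorm_sum_wave_le (by norm_num) hφ.continuousOn a (Finset.Icc 1 N) ?_ ?_
  · have := Real.log_natCast_nonneg N
    positivity
  have hN1 : 1 ≤ N := by omega
  have hsplit : energy φ a (Finset.Icc 1 N) (-1) 1 =
      energy φ a (Finset.Icc 1 N) (-1) (-0) + energy φ a (Finset.Icc 1 N) 0 1 := by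
    rw [neg_zero]
    exact energy_add_adjacent (by norm_num) (by norm_num) hφ.continuousOn a _
  have hE₂' := hE₂ N hN1 fun n => (starRingEnd ℂ) (a n)
  simp only [RCLike.norm_conj] at hE₂'
  rw [hsplit, energy_neg_eq]
  refine (add_le_add hE₂' (hE₁ N hN1 a)).trans ?_
  have hA0 : 0 ≤ ∑ n ∈ Finset.Icc 1 N, ‖a n‖ ^ 2 := Finset.sum_nonneg fun _ _ => by positivity
  have hlog : 1 + Real.log N ≤ 3 * Real.log N := by
    have h5 : Real.log 2 ≤ Real.log N :=
      Real.log_le_log (by norm_num) (by exact_mod_cast hN)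
    linarith [Real.log_two_gt_d9]
  have hlog0 : 0 ≤ Real.log N := Real.log_natCast_nonneg N
  have hpow : ((N : ℝ) ^ ((1 : ℝ) / 12)) ^ 2 = (N : ℝ) ^ ((1 : ℝ) / 6) := by
    rw [← Real.rpow_natCast, ← Real.rpow_mul (by positivity)]
    norm_num
  have hsq : (1 + Real.log N) ^ 2 ≤ (3 * Real.log N) ^ 2 := by gcongr
  calc _ = (C₁ + C₂) * (1 + Real.log N) ^ 2 * (N : ℝ) ^ ((1 : ℝ) / 6) *
        ∑ n ∈ Finset.Icc 1 N, ‖a n‖ ^ 2 := by ring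
    _ ≤ (C₁ + C₂) * (3 * Real.log N) ^ 2 * (N : ℝ) ^ ((1 : ℝ) / 6) *
        ∑ n ∈ Finset.Icc 1 N, ‖a n‖ ^ 2 := by gcongr
    _ = _ := by
        simp only [Real.rpow_one, mul_pow]
        rw [Real.sq_sqrt (by positivity : 0 ≤ C₁ + C₂), Real.sq_sqrt hA0, hpow]
        ring
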